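/- (Audenaert–Kittaneh conjecture, case p ≥ 2) Let A_1,…,A_n be complex square matrices, p ≥ 2, and 1/p + 1/q = 1. Then n·(∑_{i=1}^n ‖A_i‖_p^p)^(q/p) ≤ ‖∑_{i=1}^n A_i‖_p^q + ∑_{1≤i<j≤n} ‖A_i − A_j‖_p^q. -/

import Mathlib

open scoped ComplexOrder

/-- The Schatten `p`-(quasi)norm of a square complex matrix:
`‖X‖_p = (tr |X|^p)^(1/p)`, computed as `(∑ i, λ_i(Xᴴ * X) ^ (p/2)) ^ (1/p)`,
where `λ_i(Xᴴ * X)` are the (nonnegative) eigenvalues of `Xᴴ * X`, whose square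
roots are the singular values of `X`. -/
noncomputable def schattenNorm {m : Type*} [Fintype m] [DecidableEq m]
    (p : ℝ) (X : Matrix m m ℂ) : ℝ :=
  (∑ i, ((Matrix.posSemidef_conjTranspose_mul_self X).1.eigenvalues i ^ (p / 2))) ^ (1 / p)

open Matrix

/-- Entire functions that are bounded on the strip `0 ≤ re z ≤ 1`. -/
def BoundedOnStrip (f : ℂ → ℂ) : Prop :=
  Differentiable ℂ f ∧ ∃ C : ℝ, ∀ z : ℂ, 0 ≤ z.re → z.re ≤ 1 → ‖f z‖ ≤ C

namespace BoundedOnStrip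

lemma const (c : ℂ) : BoundedOnStrip fun _ => c :=
  ⟨differentiable_const c, ‖c‖, fun _ _ _ => le_rfl⟩

lemma mul {f g : ℂ → ℂ} (hf : BoundedOnStrip f) (hg : BoundedOnStrip g) :
    BoundedOnStrip fun z => f z * g z := by
  obtain ⟨hfd, C, hC⟩ := hf
  obtain ⟨hgd, D, hD⟩ := hg
  refine ⟨hfd.mul hgd, C * D, fun z h0 h1 => ?_⟩
  rw [norm_mul]
  exact mul_le_mul (hC z h0 h1) (hD z h0 h1) (norm_nonneg _)
    ((norm_nonneg _).trans (hC z h0 h1))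

lemma sum {ι : Type*} (s : Finset ι) {f : ι → ℂ → ℂ} (hf : ∀ i, BoundedOnStrip (f i)) :
    BoundedOnStrip fun z => ∑ i ∈ s, f i z := by
  choose hd C hC using hf
  exact ⟨Differentiable.fun_sum fun i _ => hd i, ∑ i ∈ s, C i, fun z h0 h1 =>
    norm_sum_le_of_le _ fun i _ => hC i z h0 h1⟩

lemma matrix_mul {l m n : Type*} [Fintype m] {X : ℂ → Matrix l m ℂ} {Y : ℂ → Matrix m n ℂ}
    (hX : ∀ a b, BoundedOnStrip fun z => X z a b) (hY : ∀ a b, BoundedOnStrip fun z => Y z a b)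
    (a : l) (b : n) : BoundedOnStrip fun z => (X z * Y z) a b := by
  simp only [Matrix.mul_apply]
  exact sum _ fun i => (hX a i).mul (hY i b)

lemma diagonal {m : Type*} [DecidableEq m] {d : ℂ → m → ℂ}
    (hd : ∀ i, BoundedOnStrip fun z => d z i) (a b : m) :
    BoundedOnStrip fun z => Matrix.diagonal (d z) a b := by
  by_cases h : a = b
  · subst h
    simpa only [Matrix.diagonal_apply_eq] using hd a
  · simpa only [Matrix.diagonal_apply_ne _ h] using const 0

/-- A form of the three lines theorem. -/
lemma norm_le_interp {f : ℂ → ℂ} (hf : BoundedOnStrip f) {a b t : ℝ} (h0 : 0 ≤ t) (h1 : t ≤ 1)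
    (ha : ∀ z : ℂ, z.re = 0 → ‖f z‖ ≤ a) (hb : ∀ z : ℂ, z.re = 1 → ‖f z‖ ≤ b) :
    ‖f t‖ ≤ a ^ (1 - t) * b ^ t := by
  obtain ⟨hd, C, hC⟩ := hf
  have := Complex.HadamardThreeLines.norm_le_interp_of_mem_verticalClosedStrip₀₁' f (z := (t : ℂ))
    (a := a) (b := b) (by simp [Complex.HadamardThreeLines.verticalClosedStrip, h0, h1])
    hd.diffContOnCl ⟨C, ?_⟩ (fun z hz => ha z hz) (fun z hz => hb z hz)
  · simpa using this
  · rintro _ ⟨z, hz, rfl⟩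
    exact hC z hz.1 hz.2

end BoundedOnStrip

/-- The power `s ^ w`, with the convention that all powers of `0` vanish. -/
noncomputable def suppPow (s : ℝ) (w : ℂ) : ℂ :=
  if s = 0 then 0 else Complex.exp (w * Real.log s)

lemma suppPow_zero (w : ℂ) : suppPow 0 w = 0 := if_pos rfl

lemma norm_suppPow {s : ℝ} (hs : 0 < s) (w : ℂ) : ‖suppPow s w‖ = s ^ w.re := by
  rw [suppPow, if_neg hs.ne', Complex.norm_exp, Real.rpow_def_of_pos hs]
  simp [mul_comm]

lemma suppPow_ofReal {s : ℝ} (hs : 0 < s) (x : ℝ) : suppPow s x = ((s ^ x : ℝ) : ℂ) := by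
  rw [suppPow, if_neg hs.ne', Real.rpow_def_of_pos hs]
  push_cast
  rw [mul_comm]

lemma BoundedOnStrip.suppPow {s : ℝ} (hs : 0 ≤ s) (x y : ℝ) :
    BoundedOnStrip fun z => suppPow s (x + y * z) := by
  rcases hs.eq_or_lt with rfl | hs'
  · simpa only [suppPow_zero] using BoundedOnStrip.const 0
  refine ⟨?_, s ^ x * max 1 (s ^ y), fun z h0 h1 => ?_⟩
  · simp only [_root_.suppPow, if_neg hs'.ne']
    fun_prop
  · rw [norm_suppPow hs']
    simp only [Complex.add_re, Complex.ofReal_re, Complex.mul_re, Complex.ofReal_im, zero_mul,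
      sub_zero]
    rw [Real.rpow_add hs']
    gcongr
    rw [Real.rpow_mul hs]
    rcases le_total (s ^ y) 1 with h | h
    · exact (Real.rpow_le_one (by positivity) h h0).trans (le_max_left _ _)
    · exact (Real.rpow_le_rpow_of_exponent_le h h1).trans (by simp)

lemma sum_sq_norm_eq_trace {m n : Type*} [Fintype m] [Fintype n] (X : Matrix m n ℂ) :
    ((∑ a, ∑ b, ‖X a b‖ ^ 2 : ℝ) : ℂ) = (Xᴴ * X).trace := by
  rw [Finset.sum_comm]
  simp [Matrix.trace, Matrix.mul_apply, ← Complex.normSq_eq_conj_mul_self,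
    Complex.normSq_eq_norm_sq]

lemma sum_sq_norm_mul_diagonal_mul {m : Type*} [Fintype m] [DecidableEq m]
    {E F : Matrix m m ℂ} {e d : m → ℂ} (hE : Eᴴ * E = 1) (hF : Fᴴ * F = diagonal e)
    (hed : ∀ i, e i * d i = d i) :
    ∑ a, ∑ b, ‖(F * diagonal d * Eᴴ) a b‖ ^ 2 = ∑ i, ‖d i‖ ^ 2 := by
  apply Complex.ofReal_injective
  rw [sum_sq_norm_eq_trace]
  have : (F * diagonal d * Eᴴ)ᴴ * (F * diagonal d * Eᴴ) =
      E * (diagonal (star d) * (Fᴴ * F) * diagonal d * Eᴴ) := by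
    simp [Matrix.conjTranspose_mul, Matrix.mul_assoc, diagonal_conjTranspose]
  rw [this, Matrix.trace_mul_comm, Matrix.mul_assoc, hE, hF, Matrix.mul_one, diagonal_mul_diagonal,
    diagonal_mul_diagonal, trace_diagonal]
  push_cast
  refine Finset.sum_congr rfl fun i _ => ?_
  rw [mul_assoc, hed]
  simp [← Complex.normSq_eq_conj_mul_self, Complex.normSq_eq_norm_sq]

lemma sum_sq_norm_conjTranspose {m n : Type*} [Fintype m] [Fintype n] (X : Matrix m n ℂ) :
    ∑ a, ∑ b, ‖Xᴴ a b‖ ^ 2 = ∑ a, ∑ b, ‖X a b‖ ^ 2 := by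
  rw [Finset.sum_comm]
  simp

/-- A singular value decomposition, in which the left factor is only a partial isometry. -/
lemma exists_singularValueDecomposition {m : Type*} [Fintype m] [DecidableEq m]
    (X : Matrix m m ℂ) :
    ∃ (E F : Matrix m m ℂ) (s : m → ℝ), Eᴴ * E = 1 ∧
      Fᴴ * F = diagonal (fun i => if s i = 0 then 0 else 1) ∧
      X = F * diagonal (fun i => (s i : ℂ)) * Eᴴ ∧ (∀ i, 0 ≤ s i) ∧
      ∀ p, schattenNorm p X = (∑ i, s i ^ p) ^ (1 / p) := by
  set hX := (Matrix.posSemidef_conjTranspose_mul_self X).1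
  have hnn : ∀ i, 0 ≤ hX.eigenvalues i :=
    (Matrix.posSemidef_conjTranspose_mul_self X).eigenvalues_nonneg
  set E : Matrix m m ℂ := hX.eigenvectorUnitary.1 with hEdef
  set s : m → ℝ := fun i => √(hX.eigenvalues i) with hs
  have hE : Eᴴ * E = 1 := Unitary.coe_star_mul_self hX.eigenvectorUnitary
  have hE' : E * Eᴴ = 1 := Unitary.coe_mul_star_self hX.eigenvectorUnitary
  have hdiag : Eᴴ * (Xᴴ * X) * E = diagonal (fun i => (s i : ℂ) * s i) := by
    have := hX.conjStarAlgAut_star_eigenvectorUnitary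
    rw [Unitary.conjStarAlgAut_star_apply] at this
    rw [hEdef, ← star_eq_conjTranspose, this]
    congr 1
    ext i
    simp only [Function.comp_apply, hs, ← Complex.ofReal_mul, Real.mul_self_sqrt (hnn i)]
    rfl
  have hsand : ∀ d : m → ℂ, (X * E * diagonal d)ᴴ * (X * E * diagonal d) =
      diagonal (fun i => star (d i) * (s i * s i) * d i) := by
    intro d
    have : (X * E * diagonal d)ᴴ * (X * E * diagonal d) =
        diagonal (star d) * (Eᴴ * (Xᴴ * X) * E) * diagonal d := by
      simp [Matrix.conjTranspose_mul, Matrix.mul_assoc, diagonal_conjTranspose]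
    rw [this, hdiag, diagonal_mul_diagonal, diagonal_mul_diagonal]
    rfl
  refine ⟨E, X * E * diagonal (fun i => ((s i)⁻¹ : ℂ)), s, hE, ?_, ?_,
    fun i => Real.sqrt_nonneg _, fun p => ?_⟩
  · rw [hsand]
    congr 1
    ext i
    by_cases h : s i = 0
    · simp [h]
    · have : (s i : ℂ) ≠ 0 := by exact_mod_cast h
      simp only [h, if_false, Complex.star_def, map_inv₀, Complex.conj_ofReal]
      field_simp
  · have hzero : X * E * diagonal (fun i => if s i = 0 then (1 : ℂ) else 0) = 0 := by
      rw [← conjTranspose_mul_self_eq_zero, hsand, ← diagonal_zero]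
      congr 1
      ext i
      by_cases h : s i = 0 <;> simp [h]
    have hdec : diagonal (fun i => ((s i)⁻¹ : ℂ)) * diagonal (fun i => (s i : ℂ)) =
        1 - diagonal (fun i => if s i = 0 then (1 : ℂ) else 0) := by
      rw [diagonal_mul_diagonal, ← diagonal_one, diagonal_sub]
      congr 1
      ext i
      by_cases h : s i = 0 <;> simp [h]
    rw [Matrix.mul_assoc (X * E), hdec, Matrix.mul_sub, hzero, sub_zero, Matrix.mul_one,
      Matrix.mul_assoc, hE', Matrix.mul_one]
  · rw [schattenNorm]
    congr 2
    ext i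
    simp only [hs]
    rw [Real.sqrt_eq_rpow, ← Real.rpow_mul (hnn i)]
    congr 1
    ring

section OrthogonalColumns

variable {K L : Type*} [Fintype L] [DecidableEq K]

lemma sum_ofReal_mul_ofReal {M : L → K → ℝ} {c : ℝ}
    (hM : ∀ k k', ∑ l, M l k * M l k' = if k = k' then c else 0) (k k' : K) :
    ∑ l, (M l k : ℂ) * M l k' = if k = k' then (c : ℂ) else 0 := by
  simpa [apply_ite] using congrArg (fun x : ℝ => (x : ℂ)) (hM k k')

variable [Fintype K]

lemma sum_sq_norm_sum_smul {M : L → K → ℝ} {c : ℝ}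
    (hM : ∀ k k', ∑ l, M l k * M l k' = if k = k' then c else 0) (y : K → ℂ) :
    ∑ l, ‖∑ k, (M l k : ℂ) * y k‖ ^ 2 = c * ∑ k, ‖y k‖ ^ 2 := by
  apply Complex.ofReal_injective
  push_cast
  simp only [← Complex.conj_mul', map_sum, map_mul, Complex.conj_ofReal, Finset.sum_mul_sum]
  rw [Finset.sum_comm, Finset.mul_sum]
  refine Finset.sum_congr rfl fun k _ => ?_
  rw [Finset.sum_comm]
  calc ∑ k', ∑ l, (M l k * (starRingEnd ℂ) (y k)) * (M l k' * y k')
      = ∑ k', (∑ l, (M l k : ℂ) * M l k') * ((starRingEnd ℂ) (y k) * y k') := by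
        refine Finset.sum_congr rfl fun k' _ => ?_
        rw [Finset.sum_mul]
        exact Finset.sum_congr rfl fun l _ => by ring
    _ = c * ((starRingEnd ℂ) (y k) * y k) := by
        simp [sum_ofReal_mul_ofReal hM]

lemma norm_sum_trace_sq_le {m : Type*} [Fintype m] {M : L → K → ℝ} {c : ℝ}
    (hM : ∀ k k', ∑ l, M l k * M l k' = if k = k' then c else 0)
    (Y : K → Matrix m m ℂ) (B : L → Matrix m m ℂ) :
    ‖∑ k, (Y k * ∑ l, (M l k : ℂ) • B l).trace‖ ^ 2 ≤
      c * (∑ k, ∑ a, ∑ b, ‖Y k a b‖ ^ 2) * ∑ l, ∑ a, ∑ b, ‖B l a b‖ ^ 2 := by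
  have h1 : ∑ k, (Y k * ∑ l, (M l k : ℂ) • B l).trace =
      ∑ x : L × m × m, (∑ k, (M x.1 k : ℂ) * Y k x.2.1 x.2.2) * B x.1 x.2.2 x.2.1 := by
    simp only [Fintype.sum_prod_type, Finset.sum_mul, Matrix.trace, Matrix.diag_apply,
      Matrix.mul_apply, Matrix.sum_apply, Matrix.smul_apply, Finset.mul_sum, smul_eq_mul]
    calc _ = ∑ k, ∑ l, ∑ a, ∑ b, Y k a b * ((M l k : ℂ) * B l b a) := by
          refine Finset.sum_congr rfl fun k _ => ?_
          simp_rw [Finset.sum_comm (s := (Finset.univ : Finset m)) (t := (Finset.univ : Finset L))]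
      _ = ∑ l, ∑ a, ∑ b, ∑ k, Y k a b * ((M l k : ℂ) * B l b a) := by
          simp_rw [Finset.sum_comm (s := (Finset.univ : Finset K))]
      _ = _ := by
          refine Finset.sum_congr rfl fun l _ => Finset.sum_congr rfl fun a _ =>
            Finset.sum_congr rfl fun b _ => Finset.sum_congr rfl fun k _ => ?_
          ring
  have h2 : ∑ x : L × m × m, ‖∑ k, (M x.1 k : ℂ) * Y k x.2.1 x.2.2‖ ^ 2 =
      c * ∑ k, ∑ a, ∑ b, ‖Y k a b‖ ^ 2 := by
    rw [Fintype.sum_prod_type_right]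
    simp only [sum_sq_norm_sum_smul hM, Fintype.sum_prod_type, ← Finset.mul_sum]
    congr 1
    simp_rw [Finset.sum_comm (s := (Finset.univ : Finset K))]
  have h3 : ∑ x : L × m × m, ‖B x.1 x.2.2 x.2.1‖ ^ 2 = ∑ l, ∑ a, ∑ b, ‖B l a b‖ ^ 2 := by
    simp only [Fintype.sum_prod_type]
    exact Finset.sum_congr rfl fun l _ => Finset.sum_comm
  rw [h1, ← h2, ← h3]
  refine le_trans ?_ (Finset.sum_mul_sq_le_sq_mul_sq _ _ _)
  gcongr
  exact norm_sum_le_of_le _ fun x _ => (norm_mul _ _).le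

end OrthogonalColumns

section OperatorNorm

open scoped Matrix.Norms.L2Operator

variable {m : Type*} [Fintype m] [DecidableEq m]

lemma norm_apply_le_l2_opNorm (X : Matrix m m ℂ) (a b : m) : ‖X a b‖ ≤ ‖X‖ := by
  have h := X.l2_opNorm_mulVec (EuclideanSpace.single b 1)
  rw [PiLp.norm_single, norm_one, mul_one] at h
  refine le_trans ?_ ((PiLp.norm_apply_le _ a).trans h)
  simp

lemma l2_opNorm_le_one_of_conjTranspose_mul_self {F : Matrix m m ℂ} {e : m → ℂ}
    (he : ∀ i, ‖e i‖ ≤ 1) (hF : Fᴴ * F = diagonal e) : ‖F‖ ≤ 1 := by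
  have h : ‖F‖ * ‖F‖ ≤ 1 := by
    rw [← l2_opNorm_conjTranspose_mul_self, hF, l2_opNorm_diagonal]
    exact (pi_norm_le_iff_of_nonneg zero_le_one).2 he
  nlinarith [norm_nonneg F]

lemma schattenNorm_nonneg (p : ℝ) (X : Matrix m m ℂ) : 0 ≤ schattenNorm p X :=
  Real.rpow_nonneg (Finset.sum_nonneg fun i _ =>
    Real.rpow_nonneg ((Matrix.posSemidef_conjTranspose_mul_self X).eigenvalues_nonneg i) _) _

/-- An analytic family through `X` at `2 / p` which, on the two edges of the strip, is controlled
in the operator norm and in the Hilbert–Schmidt norm respectively. -/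
lemma exists_family_l2_opNorm {p q : ℝ} (hp : 0 < p) (hq : q ≠ 0) (hpq : 1 / p + 1 / q = 1)
    (X : Matrix m m ℂ) :
    ∃ B : ℂ → Matrix m m ℂ, (∀ a b, BoundedOnStrip fun z => B z a b) ∧
      B ((2 / p : ℝ) : ℂ) = X ∧ (∀ z : ℂ, z.re = 0 → ‖B z‖ ≤ schattenNorm p X ^ q) ∧
      ∀ z : ℂ, z.re = 1 → ∑ a, ∑ b, ‖B z a b‖ ^ 2 ≤ schattenNorm p X ^ q := by
  obtain ⟨E, F, s, hE, hF, hX, hs, hnorm⟩ := exists_singularValueDecomposition X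
  have hsum : 0 ≤ ∑ i, s i ^ p := Finset.sum_nonneg fun i _ => Real.rpow_nonneg (hs i) _
  have hb0 := schattenNorm_nonneg p X
  have hbp : schattenNorm p X ^ p = ∑ i, s i ^ p := by
    rw [hnorm, ← Real.rpow_mul hsum, one_div_mul_cancel hp.ne', Real.rpow_one]
  set b := schattenNorm p X with hb
  have hbs : ∀ i, 0 < s i → 0 < b := by
    intro i hi
    refine hb0.lt_of_ne fun h => ?_
    rw [← h, Real.zero_rpow hp.ne'] at hbp
    have := (Finset.sum_eq_zero_iff_of_nonneg fun i _ => Real.rpow_nonneg (hs i) p).1 hbp.symm i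
      (Finset.mem_univ i)
    exact (Real.rpow_pos_of_pos hi p).ne' this
  set d : ℂ → m → ℂ := fun z i =>
    suppPow b (q + (-((q + p) / 2) : ℝ) * z) * suppPow (s i) ((0 : ℝ) + (p / 2 : ℝ) * z) with hd
  have hdnorm : ∀ z i, 0 < s i →
      ‖d z i‖ = b ^ (q - (q + p) / 2 * z.re) * s i ^ (p / 2 * z.re) := by
    intro z i hi
    rw [hd, norm_mul, norm_suppPow (hbs i hi), norm_suppPow hi]
    congr 2 <;> simp
    ring
  have hdzero : ∀ z i, s i = 0 → d z i = 0 := by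
    intro z i hi
    simp only [hd, hi, suppPow_zero, mul_zero]
  refine ⟨fun z => F * diagonal (d z) * Eᴴ, ?_, ?_, ?_, ?_⟩
  · refine BoundedOnStrip.matrix_mul (BoundedOnStrip.matrix_mul (fun a b => .const _)
      (BoundedOnStrip.diagonal fun i => ?_)) (fun a b => .const _)
    exact (BoundedOnStrip.suppPow hb0 _ _).mul (BoundedOnStrip.suppPow (hs i) _ _)
  · refine (congrArg (fun D => F * diagonal D * Eᴴ) (funext fun i => ?_)).trans hX.symm
    rcases (hs i).eq_or_lt with h | h
    · rw [hdzero _ _ h.symm, ← h, Complex.ofReal_zero]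
    · simp only [hd]
      rw [← Complex.ofReal_mul, ← Complex.ofReal_mul, ← Complex.ofReal_add, ← Complex.ofReal_add,
        suppPow_ofReal (hbs i h), suppPow_ofReal h]
      have h1 : q + -((q + p) / 2) * (2 / p) = 0 := by
        field_simp at hpq ⊢
        linarith
      have h2 : 0 + p / 2 * (2 / p) = 1 := by
        field_simp
        ring
      rw [h1, h2, Real.rpow_zero, Real.rpow_one, Complex.ofReal_one, one_mul]
  · intro z hz
    have hF1 : ‖F‖ ≤ 1 := l2_opNorm_le_one_of_conjTranspose_mul_self
      (fun i => by split_ifs <;> simp) hF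
    have hE1 : ‖Eᴴ‖ ≤ 1 := by
      rw [l2_opNorm_conjTranspose]
      exact l2_opNorm_le_one_of_conjTranspose_mul_self (e := fun _ => 1) (by simp)
        (hE.trans diagonal_one.symm)
    have hbq : 0 ≤ b ^ q := Real.rpow_nonneg hb0 q
    have hD1 : ‖diagonal (d z)‖ ≤ b ^ q := by
      rw [l2_opNorm_diagonal, pi_norm_le_iff_of_nonneg hbq]
      intro i
      rcases (hs i).eq_or_lt with h | h
      · rwa [hdzero _ _ h.symm, norm_zero]
      · rw [hdnorm z i h, hz]
        simp
    calc ‖F * diagonal (d z) * Eᴴ‖ ≤ ‖F‖ * ‖diagonal (d z)‖ * ‖Eᴴ‖ :=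
          (l2_opNorm_mul _ _).trans (by gcongr; exact l2_opNorm_mul _ _)
      _ ≤ 1 * b ^ q * 1 := by gcongr
      _ = b ^ q := by ring
  · intro z hz
    have key : ∀ i, ‖d z i‖ ^ 2 = b ^ (q - p) * s i ^ p := by
      intro i
      rcases (hs i).eq_or_lt with h | h
      · rw [hdzero _ _ h.symm, ← h, Real.zero_rpow hp.ne']
        simp
      · rw [hdnorm z i h, hz, mul_pow, ← Real.rpow_mul_natCast hb0, ← Real.rpow_mul_natCast (hs i)]
        congr 2 <;> push_cast <;> ring
    rw [sum_sq_norm_mul_diagonal_mul hE hF, Finset.sum_congr rfl fun i _ => key i,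
      ← Finset.mul_sum, ← hbp]
    · rcases hb0.eq_or_lt with h | h
      · rw [← h, Real.zero_rpow hp.ne', mul_zero]
        exact Real.rpow_nonneg le_rfl _
      · rw [← Real.rpow_add h, sub_add_cancel]
    · intro i
      by_cases h : s i = 0
      · simp [h, hdzero]
      · simp [h]

/-- An analytic family which norms `X` at `2 / p` and which, on the two edges of the strip, is
controlled in the trace norm and in the Hilbert–Schmidt norm respectively. -/
lemma exists_family_dual {p : ℝ} (hp : 0 < p) (X : Matrix m m ℂ) :
    ∃ Y : ℂ → Matrix m m ℂ, (∀ a b, BoundedOnStrip fun z => Y z a b) ∧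
      (Y ((2 / p : ℝ) : ℂ) * X).trace = ((schattenNorm p X ^ p : ℝ) : ℂ) ∧
      (∀ z : ℂ, z.re = 0 → ∀ K : Matrix m m ℂ, ‖(Y z * K).trace‖ ≤ schattenNorm p X ^ p * ‖K‖) ∧
      ∀ z : ℂ, z.re = 1 → ∑ a, ∑ b, ‖Y z a b‖ ^ 2 ≤ schattenNorm p X ^ p := by
  obtain ⟨E, F, s, hE, hF, hX, hs, hnorm⟩ := exists_singularValueDecomposition X
  have hsum : 0 ≤ ∑ i, s i ^ p := Finset.sum_nonneg fun i _ => Real.rpow_nonneg (hs i) _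
  have hbp : schattenNorm p X ^ p = ∑ i, s i ^ p := by
    rw [hnorm, ← Real.rpow_mul hsum, one_div_mul_cancel hp.ne', Real.rpow_one]
  rw [hbp]
  set d : ℂ → m → ℂ := fun z i => suppPow (s i) (p + (-(p / 2) : ℝ) * z) with hd
  have hdnorm : ∀ z i, 0 < s i → ‖d z i‖ = s i ^ (p - p / 2 * z.re) := by
    intro z i hi
    rw [hd, norm_suppPow hi]
    congr 1
    simp
    ring
  have hdzero : ∀ z i, s i = 0 → d z i = 0 := by
    intro z i hi
    simp only [hd, hi, suppPow_zero]
  refine ⟨fun z => E * diagonal (d z) * Fᴴ, ?_, ?_, ?_, ?_⟩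
  · exact BoundedOnStrip.matrix_mul (BoundedOnStrip.matrix_mul (fun a b => .const _)
      (BoundedOnStrip.diagonal fun i => BoundedOnStrip.suppPow (hs i) _ _)) (fun a b => .const _)
  · have : ∀ D : Matrix m m ℂ, (E * D * Fᴴ * X).trace =
        (D * (Fᴴ * F) * diagonal (fun i => (s i : ℂ))).trace := by
      intro D
      conv_lhs => rw [hX, Matrix.mul_assoc E, Matrix.mul_assoc E, Matrix.trace_mul_comm]
      simp only [Matrix.mul_assoc, hE, Matrix.mul_one]
    rw [this, hF, diagonal_mul_diagonal, diagonal_mul_diagonal, trace_diagonal,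
      Complex.ofReal_sum]
    refine Finset.sum_congr rfl fun i _ => ?_
    rcases (hs i).eq_or_lt with h | h
    · rw [← h, Real.zero_rpow hp.ne']
      simp
    · simp only [hd, h.ne', if_false, mul_one]
      rw [← Complex.ofReal_mul, ← Complex.ofReal_add, suppPow_ofReal h, ← Complex.ofReal_mul]
      congr 1
      have h1 : p + -(p / 2) * (2 / p) = p - 1 := by
        field_simp
        ring
      rw [h1, Real.rpow_sub_one h.ne', div_mul_cancel₀ _ h.ne']
  · intro z hz K
    have hF1 : ‖Fᴴ‖ ≤ 1 := by
      rw [l2_opNorm_conjTranspose]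
      exact l2_opNorm_le_one_of_conjTranspose_mul_self (fun i => by split_ifs <;> simp) hF
    have hE1 : ‖E‖ ≤ 1 := l2_opNorm_le_one_of_conjTranspose_mul_self (e := fun _ => 1) (by simp)
        (hE.trans diagonal_one.symm)
    have hK : ‖Fᴴ * K * E‖ ≤ ‖K‖ :=
      calc ‖Fᴴ * K * E‖ ≤ ‖Fᴴ‖ * ‖K‖ * ‖E‖ :=
            (l2_opNorm_mul _ _).trans (by gcongr; exact l2_opNorm_mul _ _)
        _ ≤ 1 * ‖K‖ * 1 := by gcongr
        _ = ‖K‖ := by ring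
    have htr : (E * diagonal (d z) * Fᴴ * K).trace = ∑ i, d z i * (Fᴴ * K * E) i i := by
      rw [Matrix.mul_assoc, Matrix.mul_assoc, Matrix.trace_mul_comm, Matrix.mul_assoc,
        Matrix.trace]
      simp [diagonal_mul]
    rw [htr, Finset.sum_mul]
    refine norm_sum_le_of_le _ fun i _ => ?_
    rw [norm_mul]
    refine mul_le_mul ?_ ((norm_apply_le_l2_opNorm _ i i).trans hK) (norm_nonneg _)
      (Real.rpow_nonneg (hs i) _)
    rcases (hs i).eq_or_lt with h | h
    · rw [hdzero _ _ h.symm, norm_zero]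
      exact Real.rpow_nonneg (hs i) _
    · rw [hdnorm z i h, hz, mul_zero, sub_zero]
  · intro z hz
    have : ∀ D : m → ℂ, E * diagonal D * Fᴴ = (F * diagonal (star D) * Eᴴ)ᴴ := by
      intro D
      simp [Matrix.conjTranspose_mul, Matrix.mul_assoc, diagonal_conjTranspose]
    beta_reduce
    rw [this, sum_sq_norm_conjTranspose, sum_sq_norm_mul_diagonal_mul hE hF]
    · refine Finset.sum_le_sum fun i _ => ?_
      rcases (hs i).eq_or_lt with h | h
      · rw [Pi.star_apply, hdzero _ _ h.symm, ← h, Real.zero_rpow hp.ne']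
        simp
      · rw [Pi.star_apply, norm_star, hdnorm z i h, hz, ← Real.rpow_mul_natCast (hs i)]
        apply le_of_eq
        congr 1
        push_cast
        ring
    · intro i
      by_cases h : s i = 0
      · simp [h, hdzero]
      · simp [h]

variable {K L : Type*} [Fintype K] [Fintype L] [DecidableEq K]

/-- Interpolation between the trivial `ℓ¹ → ℓ^∞` bound and the Hilbert–Schmidt bound for the
transpose of a scalar matrix `M` with orthogonal columns of equal length. -/
theorem mul_rpow_sum_schattenNorm_le {M : L → K → ℝ} {c : ℝ} (hc : 0 ≤ c)
    (hM1 : ∀ l k, |M l k| ≤ 1)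
    (hM : ∀ k k', ∑ l, M l k * M l k' = if k = k' then c else 0)
    (A : K → Matrix m m ℂ) {p q : ℝ} (hp : 2 ≤ p) (hpq : 1 / p + 1 / q = 1) :
    c * (∑ k, schattenNorm p (A k) ^ p) ^ (q / p) ≤
      ∑ l, schattenNorm p (∑ k, (M l k : ℂ) • A k) ^ q := by
  have hp0 : 0 < p := by linarith
  have hq0 : 0 < q := by
    have h1 : 1 / p < 1 := by rw [div_lt_one hp0]; linarith
    exact one_div_pos.1 (by linarith)
  choose Y hYg hYt hY0 hY1 using fun k => exists_family_dual hp0 (A k)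
  choose B hBg hBt hB0 hB1 using fun l =>
    exists_family_l2_opNorm hp0 hq0.ne' hpq (∑ k, (M l k : ℂ) • A k)
  set S := ∑ k, schattenNorm p (A k) ^ p with hS
  set R := ∑ l, schattenNorm p (∑ k, (M l k : ℂ) • A k) ^ q with hR
  have hS0 : 0 ≤ S := Finset.sum_nonneg fun k _ => Real.rpow_nonneg (schattenNorm_nonneg _ _) _
  have hR0 : 0 ≤ R := Finset.sum_nonneg fun k _ => Real.rpow_nonneg (schattenNorm_nonneg _ _) _
  set f : ℂ → ℂ := fun z => ∑ k, (Y k z * ∑ l, (M l k : ℂ) • B l z).trace with hf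
  have hfg : BoundedOnStrip f := by
    refine BoundedOnStrip.sum _ fun k => BoundedOnStrip.sum _ fun a =>
      BoundedOnStrip.matrix_mul (hYg k) (fun a b => ?_) a a
    simp only [Matrix.sum_apply, Matrix.smul_apply, smul_eq_mul]
    exact BoundedOnStrip.sum _ fun l => (BoundedOnStrip.const _).mul (hBg l a b)
  have hf0 : ∀ z : ℂ, z.re = 0 → ‖f z‖ ≤ S * R := by
    intro z hz
    rw [hS, Finset.sum_mul]
    refine norm_sum_le_of_le _ fun k _ => (hY0 k z hz _).trans ?_
    refine mul_le_mul_of_nonneg_left ?_ (Real.rpow_nonneg (schattenNorm_nonneg _ _) _)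
    refine norm_sum_le_of_le _ fun l _ => ?_
    rw [norm_smul, Complex.norm_real, Real.norm_eq_abs]
    exact (mul_le_of_le_one_left (norm_nonneg _) (hM1 l k)).trans (hB0 l z hz)
  have hf1 : ∀ z : ℂ, z.re = 1 → ‖f z‖ ≤ √(c * S * R) := by
    intro z hz
    refine Real.le_sqrt_of_sq_le ((norm_sum_trace_sq_le hM _ _).trans ?_)
    exact mul_le_mul
      (mul_le_mul_of_nonneg_left (Finset.sum_le_sum fun k _ => hY1 k z hz) hc)
      (Finset.sum_le_sum fun l _ => hB1 l z hz) (by positivity) (by positivity)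
  have hft : f ((2 / p : ℝ) : ℂ) = ((c * S : ℝ) : ℂ) := by
    have hinv : ∀ k, ∑ l, (M l k : ℂ) • B l ((2 / p : ℝ) : ℂ) = (c : ℂ) • A k := by
      intro k
      simp only [hBt, Finset.smul_sum, smul_smul]
      rw [Finset.sum_comm]
      simp only [← Finset.sum_smul]
      simp [sum_ofReal_mul_ofReal hM]
    simp only [hf, hinv, Matrix.mul_smul, Matrix.trace_smul, hYt, smul_eq_mul, hS]
    rw [← Finset.mul_sum]
    push_cast
    rfl
  have key := hfg.norm_le_interp (t := 2 / p) (by positivity) ((div_le_one hp0).2 hp) hf0 hf1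
  rw [hft, Complex.norm_real, Real.norm_of_nonneg (by positivity), Real.sqrt_eq_rpow,
    ← Real.rpow_mul (by positivity)] at key
  rcases hc.eq_or_lt with h | hc'
  · rwa [← h, zero_mul]
  rcases hS0.eq_or_lt with h | hS'
  · rw [← h, Real.zero_rpow (by positivity), mul_zero]
    exact hR0
  have hroot : c ^ (1 / q) * S ^ (1 / p) ≤ R ^ (1 / q) := by
    have hsplit : (S * R) ^ (1 - 2 / p) * (c * S * R) ^ (1 / 2 * (2 / p)) =
        c ^ (1 / p) * (S ^ (1 / q) * R ^ (1 / q)) := by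
      have e1 : 1 / 2 * (2 / p) = 1 / p := by field_simp
      have e2 : 1 / q = 1 - 2 / p + 1 / p := by linear_combination hpq
      have e3 : 1 - 2 / p + 1 / p ≠ 0 := by
        rw [← e2]
        positivity
      rw [e1, mul_assoc c, Real.mul_rpow hc (by positivity), ← Real.mul_rpow hS0 hR0, e2,
        Real.rpow_add' (by positivity) e3]
      ring
    have hcs : c * S = (c ^ (1 / p) * S ^ (1 / q)) * (c ^ (1 / q) * S ^ (1 / p)) := by
      have hone : ∀ x : ℝ, 0 < x → x ^ (1 / p) * x ^ (1 / q) = x := fun x hx => by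
        rw [← Real.rpow_add hx, hpq, Real.rpow_one]
      nth_rw 1 [← hone c hc', ← hone S hS']
      ring
    rw [hsplit, hcs, ← mul_assoc (c ^ (1 / p)) (S ^ (1 / q)) (R ^ (1 / q))] at key
    exact le_of_mul_le_mul_left key (by positivity)
  have := Real.rpow_le_rpow (by positivity) hroot hq0.le
  rwa [Real.mul_rpow (by positivity) (by positivity), ← Real.rpow_mul hc, ← Real.rpow_mul hS0,
    ← Real.rpow_mul hR0, one_div_mul_cancel hq0.ne', Real.rpow_one, Real.rpow_one,
    one_div_mul_eq_div] at this

lemma schattenNorm_zero {p : ℝ} (hp : 0 < p) : schattenNorm p (0 : Matrix m m ℂ) = 0 := by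
  have h : (Matrix.posSemidef_conjTranspose_mul_self (0 : Matrix m m ℂ)).1.eigenvalues = 0 :=
    (Matrix.IsHermitian.eigenvalues_eq_zero_iff _).2 (by simp)
  rw [schattenNorm, h]
  simp only [Pi.zero_apply]
  rw [Real.zero_rpow (by positivity), Finset.sum_const_zero, Real.zero_rpow (by positivity)]

end OperatorNorm

/-- The coefficients of the sum and of the pairwise differences of `n` vectors. -/
def sumDiffCoeff (n : ℕ) : Option (Fin n × Fin n) → Fin n → ℝ
  | none, _ => 1
  | some (i, j), k => if i < j then (if k = i then 1 else 0) - (if k = j then 1 else 0) else 0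

lemma abs_sumDiffCoeff_le (n : ℕ) (l : Option (Fin n × Fin n)) (k : Fin n) :
    |sumDiffCoeff n l k| ≤ 1 := by
  rcases l with _ | ⟨i, j⟩
  · simp [sumDiffCoeff]
  · simp only [sumDiffCoeff]
    split_ifs <;> simp

lemma sum_sumDiffCoeff_mul (n : ℕ) (k k' : Fin n) :
    ∑ l, sumDiffCoeff n l k * sumDiffCoeff n l k' = if k = k' then (n : ℝ) else 0 := by
  set g : Fin n → Fin n → ℝ := fun i j =>
    ((if k = i then 1 else 0) - (if k = j then 1 else 0)) *
      ((if k' = i then 1 else 0) - (if k' = j then 1 else 0)) with hg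
  have h1 : ∑ l, sumDiffCoeff n l k * sumDiffCoeff n l k' =
      1 + ∑ i, ∑ j, if i < j then g i j else 0 := by
    rw [Fintype.sum_option, Fintype.sum_prod_type]
    congr 1
    · simp [sumDiffCoeff]
    · refine Finset.sum_congr rfl fun i _ => Finset.sum_congr rfl fun j _ => ?_
      by_cases h : i < j <;> simp [sumDiffCoeff, hg, h]
  have h2 : ∑ i, ∑ j, g i j = 2 * ∑ i, ∑ j, if i < j then g i j else 0 := by
    rw [two_mul]
    nth_rw 3 [Finset.sum_comm]
    simp only [← Finset.sum_add_distrib]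
    refine Finset.sum_congr rfl fun i _ => Finset.sum_congr rfl fun j _ => ?_
    rcases lt_trichotomy i j with h | h | h
    · simp [h, h.not_gt]
    · simp [h, hg]
    · simp only [h, h.not_gt, if_true, if_false, zero_add, hg]
      ring
  have h3 : ∑ i, ∑ j, g i j = 2 * (if k = k' then (n : ℝ) else 0) - 2 := by
    simp only [hg, mul_sub, sub_mul, Finset.sum_sub_distrib, ← Finset.mul_sum, ← Finset.sum_mul]
    by_cases h : k = k'
    · subst h
      simp
      ring
    · simp [h]
      ring
  rw [h1]
  linarith

theorem audenaert_kittaneh_p_ge_two {m : Type*} [Fintype m] [DecidableEq m] (n : ℕ)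
    (A : Fin n → Matrix m m ℂ)
    (p q : ℝ) (hp : 2 ≤ p) (hpq : 1 / p + 1 / q = 1) :
    (n : ℝ) * (∑ i, schattenNorm p (A i) ^ p) ^ (q / p) ≤
      schattenNorm p (∑ i, A i) ^ q +
        ∑ i, ∑ j ∈ Finset.Ioi i, schattenNorm p (A i - A j) ^ q := by
  have h := mul_rpow_sum_schattenNorm_le (Nat.cast_nonneg n) (abs_sumDiffCoeff_le n)
    (sum_sumDiffCoeff_mul n) A hp hpq
  refine h.trans_eq ?_
  have hq : q ≠ 0 := by
    rintro rfl
    have : 1 / p ≤ 1 / 2 := one_div_le_one_div_of_le two_pos hp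
    norm_num at hpq this
    linarith
  have hzero : schattenNorm p (0 : Matrix m m ℂ) ^ q = 0 := by
    rw [schattenNorm_zero (by linarith), Real.zero_rpow hq]
  rw [Fintype.sum_option, Fintype.sum_prod_type]
  refine congrArg₂ (· + ·) ?_ ?_
  · simp only [sumDiffCoeff, Complex.ofReal_one, one_smul]
  · refine Finset.sum_congr rfl fun i _ => ?_
    rw [← Finset.filter_lt_eq_Ioi, Finset.sum_filter]
    refine Finset.sum_congr rfl fun j _ => ?_
    by_cases h : i < j
    · have : ∑ k, (sumDiffCoeff n (some (i, j)) k : ℂ) • A k = A i - A j := by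
        simp [sumDiffCoeff, h, sub_smul, ite_smul]
      rw [if_pos h, this]
    · have : ∑ k, (sumDiffCoeff n (some (i, j)) k : ℂ) • A k = 0 := by
        simp [sumDiffCoeff, h]
      rw [if_neg h, this, hzero]
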